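/- Let D = {λ > 0 : q ↦ 𝓕(λ,q) has a unique maximizer q*(λ) over [0,∞)} and f(λ) = sup_{q ≥ 0} 𝓕(λ,q). Then: (i) the complement of D in (0,∞) is countable; (ii) D is exactly the set of λ > 0 at which f is differentiable; (iii) for every λ ∈ D, f′(λ) = q*(λ)²/4. -/

import Mathlib

/-!
Let `D = {λ > 0 : q ↦ 𝓕(λ,q) has a unique maximizer q*(λ) over [0,∞)}` and
`f(λ) = sup_{q ≥ 0} 𝓕(λ,q)`. Then:
(i) the complement of `D` in `(0,∞)` is countable;
(ii) `D` is exactly the set of `λ > 0` at which `f` is differentiable;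
(iii) for every `λ ∈ D`, `f′(λ) = q*(λ)² / 4`.
-/

open MeasureTheory ProbabilityTheory Filter Finset Real

noncomputable section

/-- The standard Gaussian measure on `ℝ`. -/
def stdGauss : Measure ℝ := gaussianReal 0 1

/-- The scalar free energy
`ψ_{P0}(γ) = E[log ∫ exp(√γ Z x + γ x X − (γ/2) x²) dP0(x)]`. -/
def scalarFE (P0 : Measure ℝ) (γ : ℝ) : ℝ :=
  ∫ x0, (∫ z,
      Real.log (∫ x,
        Real.exp (Real.sqrt γ * z * x + γ * x * x0 - γ / 2 * x ^ 2) ∂P0)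
    ∂stdGauss) ∂P0

/-- The Replica-Symmetric potential `𝓕(λ, q) = ψ_{P0}(λ q) − (λ/4) q²`. -/
def RSpot (P0 : Measure ℝ) (lam q : ℝ) : ℝ :=
  scalarFE P0 (lam * q) - lam / 4 * q ^ 2

/-- `f(λ) = sup_{q ≥ 0} 𝓕(λ, q)`. -/
def RSsup (P0 : Measure ℝ) (lam : ℝ) : ℝ :=
  sSup (RSpot P0 lam '' Set.Ici 0)

/-- `q` is a maximizer of `q ↦ 𝓕(λ, q)` over `[0, ∞)`. -/
def Maximizes (P0 : Measure ℝ) (lam q : ℝ) : Prop :=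
  0 ≤ q ∧ ∀ q' ≥ (0 : ℝ), RSpot P0 lam q' ≤ RSpot P0 lam q

/-- `D`: the set of `λ > 0` such that `q ↦ 𝓕(λ, q)` has a unique maximizer over `[0, ∞)`. -/
def Dset (P0 : Measure ℝ) : Set ℝ :=
  {lam | 0 < lam ∧ ∃! q, Maximizes P0 lam q}

/-! ### Linear perturbations of a function of sublinear growth -/

/-- `s` maximizes `a ↦ h a - t a` over `[0, ∞)`. -/
def IsTiltMax (h : ℝ → ℝ) (t s : ℝ) : Prop :=
  0 ≤ s ∧ ∀ a ≥ (0 : ℝ), h a - t * a ≤ h s - t * s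

/-- The supremum over `a ≥ 0` of `h a - t a`. -/
def tiltSup (h : ℝ → ℝ) (t : ℝ) : ℝ :=
  sSup ((fun a => h a - t * a) '' Set.Ici 0)

theorem IsTiltMax.tiltSup_eq {h : ℝ → ℝ} {t s : ℝ} (hs : IsTiltMax h t s) :
    tiltSup h t = h s - t * s := by
  refine IsGreatest.csSup_eq ⟨⟨s, hs.1, rfl⟩, ?_⟩
  rintro _ ⟨a, ha, rfl⟩
  exact hs.2 a ha

theorem IsTiltMax.antitone {h : ℝ → ℝ} {t t' s s' : ℝ} (hs : IsTiltMax h t s)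
    (hs' : IsTiltMax h t' s') (htt' : t < t') : s' ≤ s := by
  have h1 := hs.2 s' hs'.1
  have h2 := hs'.2 s hs.1
  by_contra! hlt
  nlinarith [mul_pos (sub_pos.2 htt') (sub_pos.2 hlt)]

theorem countable_tiltMax_not_unique (h : ℝ → ℝ) :
    {t | ∃ a b, a < b ∧ IsTiltMax h t a ∧ IsTiltMax h t b}.Countable := by
  have key : ∀ t : {t | ∃ a b, a < b ∧ IsTiltMax h t a ∧ IsTiltMax h t b},
      ∃ r : ℚ, ∃ a b : ℝ, a < r ∧ r < b ∧ IsTiltMax h t a ∧ IsTiltMax h t b := by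
    rintro ⟨t, a, b, hab, ha, hb⟩
    obtain ⟨r, h1, h2⟩ := exists_rat_btwn hab
    exact ⟨r, a, b, h1, h2, ha, hb⟩
  choose r a b har hrb ha hb using key
  have hlt : ∀ t t' : {t | ∃ a b, a < b ∧ IsTiltMax h t a ∧ IsTiltMax h t b},
      (t : ℝ) < t' → (r t' : ℝ) < r t := fun t t' htt' =>
    ((hrb t').trans_le ((ha t).antitone (hb t') htt')).trans (har t)
  have hinj : Function.Injective r := by
    intro t t' heq
    rcases lt_trichotomy (t : ℝ) t' with hl | hl | hl
    · exact absurd (hlt _ _ hl) (by simp [heq])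
    · exact Subtype.ext hl
    · exact absurd (hlt _ _ hl) (by simp [heq])
  exact Set.countable_coe_iff.1 hinj.countable

section Growth

variable {h : ℝ → ℝ} {t : ℝ}

theorem exists_isTiltMax (hc : Continuous h)
    (hg : ∀ ε > 0, ∃ C, ∀ s ≥ (0 : ℝ), h s ≤ ε * s + C) (ht : 0 < t) :
    ∃ s, IsTiltMax h t s := by
  obtain ⟨C, hC⟩ := hg (t / 2) (by positivity)
  set S := max 0 (2 * (C - h 0) / t) with hS
  obtain ⟨s, hs, hmax⟩ := (isCompact_Icc (a := (0 : ℝ)) (b := S)).exists_isMaxOn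
    ⟨0, le_rfl, le_max_left _ _⟩ (f := fun a => h a - t * a) (by fun_prop)
  refine ⟨s, hs.1, fun a ha => ?_⟩
  rcases le_total a S with haS | haS
  · exact hmax ⟨ha, haS⟩
  · have h0 : h 0 - t * 0 ≤ h s - t * s := hmax ⟨le_rfl, le_max_left _ _⟩
    have h1 : 2 * (C - h 0) / t ≤ a := (le_max_right _ _).trans haS
    rw [div_le_iff₀ ht] at h1
    linarith [hC a ha]

theorem IsTiltMax.hasDerivAt_eq {s d : ℝ} (hc : Continuous h)
    (hg : ∀ ε > 0, ∃ C, ∀ s ≥ (0 : ℝ), h s ≤ ε * s + C) (ht : 0 < t)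
    (hs : IsTiltMax h t s) (hd : HasDerivAt (tiltSup h) d t) : d = -s := by
  have hmin : IsLocalMin (fun t' => tiltSup h t' + t' * s) t := by
    filter_upwards [lt_mem_nhds ht] with t' ht'
    obtain ⟨s', hs'⟩ := exists_isTiltMax hc hg ht'
    rw [hs.tiltSup_eq, hs'.tiltSup_eq]
    linarith [hs'.2 s hs.1]
  have := hmin.hasDerivAt_eq_zero (hd.add ((hasDerivAt_id t).mul_const s))
  linarith

theorem tendsto_of_isTiltMax {m : ℝ → ℝ} {s : ℝ} (hc : Continuous h)
    (hg : ∀ ε > 0, ∃ C, ∀ s ≥ (0 : ℝ), h s ≤ ε * s + C) (ht : 0 < t)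
    (hm : ∀ t' > 0, IsTiltMax h t' (m t')) (huniq : ∀ a, IsTiltMax h t a → a = s) :
    Tendsto m (nhds t) (nhds s) := by
  obtain ⟨C, hC⟩ := hg (t / 4) (by positivity)
  refine (isCompact_Icc (a := (0 : ℝ)) (b := 4 * (C - h 0) / t)).tendsto_nhds_of_unique_mapClusterPt
    ?_ ?_
  · filter_upwards [lt_mem_nhds (half_lt_self ht)] with t' ht'
    have hm' := hm t' (by linarith)
    refine ⟨hm'.1, ?_⟩
    rw [le_div_iff₀ ht]
    have h1 := hm'.2 0 le_rfl
    have h2 := hC _ hm'.1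
    nlinarith [mul_nonneg hm'.1 (sub_pos.2 ht').le]
  · intro x hx hcl
    refine huniq x ⟨hx.1, fun a ha => ?_⟩
    obtain ⟨U, hU, hUx⟩ := mapClusterPt_iff_ultrafilter.1 hcl
    have hid : Tendsto (fun t' : ℝ => t') U (nhds t) := hU
    refine le_of_tendsto_of_tendsto ((tendsto_const_nhds (x := h a)).sub (hid.mul_const a))
      (((hc.tendsto x).comp hUx).sub (hid.mul hUx)) ?_
    filter_upwards [hU (lt_mem_nhds ht)] with t' ht'
    exact (hm t' ht').2 a ha

theorem IsTiltMax.hasDerivAt_of_unique {s : ℝ} (hc : Continuous h)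
    (hg : ∀ ε > 0, ∃ C, ∀ s ≥ (0 : ℝ), h s ≤ ε * s + C) (ht : 0 < t)
    (hs : IsTiltMax h t s) (huniq : ∀ a, IsTiltMax h t a → a = s) :
    HasDerivAt (tiltSup h) (-s) t := by
  have hex : ∀ t' : ℝ, ∃ a, 0 < t' → IsTiltMax h t' a := fun t' => by
    by_cases h0 : 0 < t'
    · obtain ⟨a, ha⟩ := exists_isTiltMax hc hg h0
      exact ⟨a, fun _ => ha⟩
    · exact ⟨0, fun h1 => absurd h1 h0⟩
  choose m hm using hex
  have hlim := tendsto_of_isTiltMax hc hg ht hm huniq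
  rw [hasDerivAt_iff_isLittleO, Asymptotics.isLittleO_iff]
  intro ε hε
  filter_upwards [lt_mem_nhds ht, Metric.tendsto_nhds.1 hlim ε hε] with t' ht' hclose
  rw [Real.dist_eq] at hclose
  rw [hs.tiltSup_eq, (hm t' ht').tiltSup_eq, Real.norm_eq_abs, Real.norm_eq_abs, smul_eq_mul]
  have h1 := hs.2 _ (hm t' ht').1
  have h2 := (hm t' ht').2 s hs.1
  have h3 : |m t' - s| * |t' - t| ≤ ε * |t' - t| := by gcongr
  rw [← abs_mul] at h3
  refine le_trans ?_ h3
  rw [abs_of_nonneg (by linarith), ← abs_neg]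
  refine le_trans ?_ (le_abs_self _)
  linarith

end Growth

/-! ### Regularity and growth of the scalar free energy -/

/-- The exponent of the scalar channel, with signal-to-noise ratio `u ^ 2`. -/
def channelExponent (u : ℝ) (p : ℝ × ℝ) (x : ℝ) : ℝ :=
  u * p.2 * x + u ^ 2 * x * p.1 - u ^ 2 / 2 * x ^ 2

/-- The log-partition function of the scalar channel with signal-to-noise ratio `u ^ 2`,
as a function of the pair (signal, noise). -/
def channelLogZ (P0 : Measure ℝ) (u : ℝ) (p : ℝ × ℝ) : ℝ :=
  Real.log (∫ x, Real.exp (channelExponent u p x) ∂P0)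

theorem channelExponent_le (u : ℝ) (p : ℝ × ℝ) (x : ℝ) :
    channelExponent u p x ≤ p.2 ^ 2 + u ^ 2 * p.1 ^ 2 := by
  unfold channelExponent
  nlinarith [sq_nonneg (u * x - (p.2 + u * p.1)), sq_nonneg (p.2 - u * p.1)]

theorem le_channelExponent (u : ℝ) (p : ℝ × ℝ) (x : ℝ) :
    -(u ^ 2 * x ^ 2) - (p.2 ^ 2 + u ^ 2 * p.1 ^ 2) ≤ channelExponent u p x := by
  unfold channelExponent
  nlinarith [sq_nonneg (u * x + (p.2 + u * p.1)), sq_nonneg (p.2 - u * p.1)]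

section Channel

variable (P0 : Measure ℝ) [IsProbabilityMeasure P0]

theorem integrable_exp_channelExponent (u : ℝ) (p : ℝ × ℝ) :
    Integrable (fun x => Real.exp (channelExponent u p x)) P0 := by
  refine Integrable.of_bound (C := Real.exp (p.2 ^ 2 + u ^ 2 * p.1 ^ 2)) ?_ ?_
  · unfold channelExponent
    exact (by fun_prop : Continuous _).aestronglyMeasurable
  · refine ae_of_all _ fun x => ?_
    rw [Real.norm_eq_abs, Real.abs_exp]
    exact Real.exp_le_exp.2 (channelExponent_le u p x)

theorem integral_exp_channelExponent_pos (u : ℝ) (p : ℝ × ℝ) :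
    0 < ∫ x, Real.exp (channelExponent u p x) ∂P0 :=
  integral_exp_pos (integrable_exp_channelExponent P0 u p)

theorem channelLogZ_le (u : ℝ) (p : ℝ × ℝ) :
    channelLogZ P0 u p ≤ p.2 ^ 2 + u ^ 2 * p.1 ^ 2 := by
  unfold channelLogZ
  rw [Real.log_le_iff_le_exp (integral_exp_channelExponent_pos P0 u p)]
  calc ∫ x, Real.exp (channelExponent u p x) ∂P0
      ≤ ∫ _, Real.exp (p.2 ^ 2 + u ^ 2 * p.1 ^ 2) ∂P0 :=
        integral_mono (integrable_exp_channelExponent P0 u p) (integrable_const _)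
          fun x => Real.exp_le_exp.2 (channelExponent_le u p x)
    _ = _ := by simp

variable {P0}

theorem le_channelLogZ (hmom : Integrable (fun x => x ^ 2) P0) (u : ℝ) (p : ℝ × ℝ) :
    -(u ^ 2 * ∫ x, x ^ 2 ∂P0) - (p.2 ^ 2 + u ^ 2 * p.1 ^ 2) ≤ channelLogZ P0 u p := by
  unfold channelLogZ
  rw [Real.le_log_iff_exp_le (integral_exp_channelExponent_pos P0 u p)]
  set W : ℝ → ℝ := fun x => -(u ^ 2 * x ^ 2) - (p.2 ^ 2 + u ^ 2 * p.1 ^ 2)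
  have hsq : Integrable (fun x => -(u ^ 2 * x ^ 2)) P0 := (hmom.const_mul _).neg
  have hW : Integrable W P0 := hsq.sub (integrable_const _)
  have hWi : ∫ x, W x ∂P0 = -(u ^ 2 * ∫ x, x ^ 2 ∂P0) - (p.2 ^ 2 + u ^ 2 * p.1 ^ 2) := by
    simp only [W]
    rw [integral_sub hsq (integrable_const _), integral_neg, integral_const_mul]
    simp
  rw [← hWi]
  set w := ∫ x, W x ∂P0
  have hWw : Integrable (fun x => W x - w) P0 := hW.sub (integrable_const _)
  have hle : ∀ x, Real.exp w * (W x - w + 1) ≤ Real.exp (channelExponent u p x) := fun x =>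
    calc Real.exp w * (W x - w + 1) ≤ Real.exp w * Real.exp (W x - w) := by
          gcongr; exact Real.add_one_le_exp _
      _ = Real.exp (W x) := by rw [← Real.exp_add]; congr 1; ring
      _ ≤ _ := Real.exp_le_exp.2 (le_channelExponent u p x)
  calc Real.exp w = ∫ x, Real.exp w * (W x - w + 1) ∂P0 := by
        rw [integral_const_mul, integral_add hWw (integrable_const _), integral_sub hW (integrable_const _)]
        simp [w]
    _ ≤ _ := integral_mono ((hWw.add (integrable_const _)).const_mul _)
        (integrable_exp_channelExponent P0 u p) hle

variable (P0)

theorem continuous_channelLogZ (p : ℝ × ℝ) : Continuous fun u => channelLogZ P0 u p := by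
  unfold channelLogZ
  refine Continuous.log ?_ fun u => (integral_exp_channelExponent_pos P0 u p).ne'
  rw [continuous_iff_continuousAt]
  intro u₀
  refine continuousAt_of_dominated
    (bound := fun _ => Real.exp (p.2 ^ 2 + (u₀ ^ 2 + 1) * p.1 ^ 2)) ?_ ?_ (integrable_const _) ?_
  · exact Eventually.of_forall fun u => (integrable_exp_channelExponent P0 u p).1
  · have hev : ∀ᶠ u : ℝ in nhds u₀, u ^ 2 < u₀ ^ 2 + 1 :=
      ((continuous_pow 2).tendsto u₀).eventually_lt_const (lt_add_one _)
    filter_upwards [hev] with u hu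
    refine ae_of_all _ fun x => ?_
    rw [Real.norm_eq_abs, Real.abs_exp]
    refine Real.exp_le_exp.2 ((channelExponent_le u p x).trans ?_)
    gcongr
  · refine ae_of_all _ fun x => ?_
    unfold channelExponent
    exact (by fun_prop : Continuous _).continuousAt

theorem measurable_channelLogZ (u : ℝ) : Measurable (channelLogZ P0 u) := by
  unfold channelLogZ
  have hm : StronglyMeasurable
      (fun r : (ℝ × ℝ) × ℝ => Real.exp (channelExponent u r.1 r.2)) := by
    unfold channelExponent
    exact (by fun_prop : Continuous _).stronglyMeasurable
  exact Real.measurable_log.comp hm.integral_prod_right'.measurable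

instance : IsProbabilityMeasure stdGauss :=
  inferInstanceAs (IsProbabilityMeasure (gaussianReal 0 1))

theorem integrable_sq_stdGauss : Integrable (fun z => z ^ 2) stdGauss :=
  (memLp_id_gaussianReal (μ := 0) (v := 1) 2).integrable_sq

variable {P0}

theorem integrable_channel_bound (hmom : Integrable (fun x => x ^ 2) P0) (c d : ℝ) :
    Integrable (fun p : ℝ × ℝ => p.2 ^ 2 + c * p.1 ^ 2 + d) (P0.prod stdGauss) :=
  ((integrable_sq_stdGauss.comp_snd P0).add ((hmom.comp_fst stdGauss).const_mul c)).add
    (integrable_const d)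

theorem abs_channelLogZ_le (hmom : Integrable (fun x => x ^ 2) P0) (u : ℝ) (p : ℝ × ℝ) :
    |channelLogZ P0 u p| ≤ p.2 ^ 2 + u ^ 2 * p.1 ^ 2 + u ^ 2 * ∫ x, x ^ 2 ∂P0 := by
  have h0 : 0 ≤ u ^ 2 * ∫ x, x ^ 2 ∂P0 :=
    mul_nonneg (sq_nonneg u) (integral_nonneg fun x => sq_nonneg x)
  rw [abs_le]
  constructor <;> linarith [channelLogZ_le P0 u p, le_channelLogZ hmom u p]

theorem integrable_channelLogZ (hmom : Integrable (fun x => x ^ 2) P0) (u : ℝ) :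
    Integrable (channelLogZ P0 u) (P0.prod stdGauss) :=
  (integrable_channel_bound hmom (u ^ 2) (u ^ 2 * ∫ x, x ^ 2 ∂P0)).mono'
    (measurable_channelLogZ P0 u).aestronglyMeasurable
    (ae_of_all _ fun p => abs_channelLogZ_le hmom u p)

theorem continuous_integral_channelLogZ (hmom : Integrable (fun x => x ^ 2) P0) :
    Continuous fun u => ∫ p, channelLogZ P0 u p ∂(P0.prod stdGauss) := by
  rw [continuous_iff_continuousAt]
  intro u₀
  refine continuousAt_of_dominated (bound := fun p : ℝ × ℝ =>
    p.2 ^ 2 + (u₀ ^ 2 + 1) * p.1 ^ 2 + (u₀ ^ 2 + 1) * ∫ x, x ^ 2 ∂P0) ?_ ?_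
    (integrable_channel_bound hmom _ _) ?_
  · exact Eventually.of_forall fun u => (measurable_channelLogZ P0 u).aestronglyMeasurable
  · have hev : ∀ᶠ u : ℝ in nhds u₀, u ^ 2 < u₀ ^ 2 + 1 :=
      ((continuous_pow 2).tendsto u₀).eventually_lt_const (lt_add_one _)
    have h0 : 0 ≤ ∫ x, x ^ 2 ∂P0 := integral_nonneg fun x => sq_nonneg x
    filter_upwards [hev] with u hu
    refine ae_of_all _ fun p => (abs_channelLogZ_le hmom u p).trans ?_
    gcongr
  · exact ae_of_all _ fun p => (continuous_channelLogZ P0 p).continuousAt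

theorem scalarFE_eq_integral_prod (hmom : Integrable (fun x => x ^ 2) P0) {γ : ℝ} (hγ : 0 ≤ γ) :
    scalarFE P0 γ = ∫ p, channelLogZ P0 (√γ) p ∂(P0.prod stdGauss) := by
  rw [integral_prod _ (integrable_channelLogZ hmom _)]
  simp only [scalarFE, channelLogZ, channelExponent, Real.sq_sqrt hγ]

theorem scalarFE_le (hmom : Integrable (fun x => x ^ 2) P0) {γ : ℝ} (hγ : 0 ≤ γ) :
    scalarFE P0 γ ≤ (∫ z, z ^ 2 ∂stdGauss) + γ * ∫ x, x ^ 2 ∂P0 := by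
  rw [scalarFE_eq_integral_prod hmom hγ]
  have h1 := integrable_sq_stdGauss.comp_snd P0
  have h2 := (hmom.comp_fst stdGauss).const_mul γ
  calc _ ≤ ∫ p : ℝ × ℝ, (p.2 ^ 2 + γ * p.1 ^ 2) ∂(P0.prod stdGauss) := by
        refine integral_mono (integrable_channelLogZ hmom _) (h1.add h2) fun p => ?_
        have := channelLogZ_le P0 (√γ) p
        rwa [Real.sq_sqrt hγ] at this
    _ = _ := by
        rw [integral_add h1 h2, integral_const_mul, integral_fun_snd (fun z : ℝ => z ^ 2),
          integral_fun_fst (fun z : ℝ => z ^ 2)]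
        simp

/-- The scalar free energy as a function of `s = γ ^ 2 / 4`. -/
def quadFE (P0 : Measure ℝ) (s : ℝ) : ℝ :=
  scalarFE P0 (2 * √s)

theorem continuous_quadFE (hmom : Integrable (fun x => x ^ 2) P0) : Continuous (quadFE P0) := by
  have heq : quadFE P0 = fun s => ∫ p, channelLogZ P0 (√(2 * √s)) p ∂(P0.prod stdGauss) :=
    funext fun s => scalarFE_eq_integral_prod hmom (by positivity)
  rw [heq]
  exact (continuous_integral_channelLogZ hmom).comp (by fun_prop : Continuous fun s => √(2 * √s))

theorem quadFE_growth (hmom : Integrable (fun x => x ^ 2) P0) :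
    ∀ ε > 0, ∃ C, ∀ s ≥ (0 : ℝ), quadFE P0 s ≤ ε * s + C := by
  intro ε hε
  set v := ∫ x, x ^ 2 ∂P0
  refine ⟨(∫ z, z ^ 2 ∂stdGauss) + v ^ 2 / ε, fun s hs => ?_⟩
  have h1 : quadFE P0 s ≤ (∫ z, z ^ 2 ∂stdGauss) + 2 * √s * v := scalarFE_le hmom (by positivity)
  have h2 : 2 * √s * v ≤ ε * s + v ^ 2 / ε := by
    have h3 : ε * s + v ^ 2 / ε - 2 * √s * v = (ε * √s - v) ^ 2 / ε := by
      field_simp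
      linear_combination (-ε ^ 2) * Real.sq_sqrt hs
    linarith [show 0 ≤ (ε * √s - v) ^ 2 / ε by positivity]
  linarith

end Channel

/-! ### The Replica-Symmetric potential as a linear perturbation -/

section Potential

variable {P0 : Measure ℝ} {lam q : ℝ}

theorem RSpot_eq (hlam : 0 < lam) (hq : 0 ≤ q) :
    RSpot P0 lam q = quadFE P0 ((lam * q) ^ 2 / 4) - lam⁻¹ * ((lam * q) ^ 2 / 4) := by
  have h1 : 2 * √((lam * q) ^ 2 / 4) = lam * q := by
    rw [show (lam * q) ^ 2 / 4 = (lam * q / 2) ^ 2 by ring, Real.sqrt_sq (by positivity)]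
    ring
  rw [RSpot, quadFE, h1]
  field_simp

theorem exists_sq_param (hlam : 0 < lam) {s : ℝ} (hs : 0 ≤ s) :
    ∃ q ≥ 0, (lam * q) ^ 2 / 4 = s := by
  refine ⟨2 * √s / lam, by positivity, ?_⟩
  rw [mul_div_cancel₀ _ hlam.ne', mul_pow, Real.sq_sqrt hs]
  ring

theorem RSsup_eq (hlam : 0 < lam) : RSsup P0 lam = tiltSup (quadFE P0) lam⁻¹ := by
  unfold RSsup tiltSup
  congr 1
  ext y
  constructor
  · rintro ⟨q, hq, rfl⟩
    exact ⟨(lam * q) ^ 2 / 4, Set.mem_Ici.2 (by positivity), (RSpot_eq hlam hq).symm⟩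
  · rintro ⟨s, hs, rfl⟩
    obtain ⟨q, hq, rfl⟩ := exists_sq_param hlam hs
    exact ⟨q, hq, RSpot_eq hlam hq⟩

theorem maximizes_iff (hlam : 0 < lam) (hq : 0 ≤ q) :
    Maximizes P0 lam q ↔ IsTiltMax (quadFE P0) lam⁻¹ ((lam * q) ^ 2 / 4) := by
  constructor
  · rintro ⟨-, hmax⟩
    refine ⟨by positivity, fun a ha => ?_⟩
    obtain ⟨q', hq', rfl⟩ := exists_sq_param hlam ha
    rw [← RSpot_eq hlam hq', ← RSpot_eq hlam hq]
    exact hmax q' hq'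
  · rintro ⟨-, hmax⟩
    refine ⟨hq, fun q' hq' => ?_⟩
    rw [RSpot_eq hlam hq', RSpot_eq hlam hq]
    exact hmax _ (by positivity)

theorem sq_param_injective (hlam : 0 < lam) {q' : ℝ} (hq : 0 ≤ q) (hq' : 0 ≤ q')
    (heq : (lam * q) ^ 2 / 4 = (lam * q') ^ 2 / 4) : q = q' := by
  have h1 : (lam * q) ^ 2 = (lam * q') ^ 2 := by linarith
  rw [sq_eq_sq₀ (by positivity) (by positivity)] at h1
  exact mul_left_cancel₀ hlam.ne' h1

theorem mem_Dset_iff (hlam : 0 < lam) :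
    lam ∈ Dset P0 ↔ ∃! s, IsTiltMax (quadFE P0) lam⁻¹ s := by
  constructor
  · rintro ⟨-, q, hq, huniq⟩
    refine ⟨_, (maximizes_iff hlam hq.1).1 hq, fun s hs => ?_⟩
    obtain ⟨q', hq', rfl⟩ := exists_sq_param hlam hs.1
    rw [huniq q' ((maximizes_iff hlam hq').2 hs)]
  · rintro ⟨s, hs, huniq⟩
    obtain ⟨q, hq, rfl⟩ := exists_sq_param hlam hs.1
    exact ⟨hlam, q, (maximizes_iff hlam hq).2 hs, fun q' hq' =>
      sq_param_injective hlam hq'.1 hq (huniq _ ((maximizes_iff hlam hq'.1).1 hq'))⟩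

theorem RSsup_eventuallyEq (hlam : 0 < lam) :
    RSsup P0 =ᶠ[nhds lam] fun l => tiltSup (quadFE P0) l⁻¹ := by
  filter_upwards [lt_mem_nhds hlam] with l hl using RSsup_eq hl

theorem differentiableAt_tiltSup (hlam : 0 < lam) (hd : DifferentiableAt ℝ (RSsup P0) lam) :
    DifferentiableAt ℝ (tiltSup (quadFE P0)) lam⁻¹ := by
  have h1 : DifferentiableAt ℝ (fun l => tiltSup (quadFE P0) l⁻¹) lam :=
    hd.congr_of_eventuallyEq (RSsup_eventuallyEq hlam).symm
  have h2 := DifferentiableAt.comp (lam⁻¹) (by rwa [inv_inv])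
    (differentiableAt_inv (𝕜 := ℝ) (inv_ne_zero hlam.ne')) (g := fun l => tiltSup (quadFE P0) l⁻¹)
  simpa [Function.comp_def] using h2

theorem hasDerivAt_RSsup [IsProbabilityMeasure P0] (hmom : Integrable (fun x => x ^ 2) P0)
    (hD : lam ∈ Dset P0) (hq : Maximizes P0 lam q) :
    HasDerivAt (RSsup P0) (q ^ 2 / 4) lam := by
  have hlam := hD.1
  have hs := (maximizes_iff hlam hq.1).1 hq
  have h1 := hs.hasDerivAt_of_unique (continuous_quadFE hmom) (quadFE_growth hmom)
    (inv_pos.2 hlam) fun a ha => ((mem_Dset_iff hlam).1 hD).unique ha hs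
  have h2 := (h1.comp lam (hasDerivAt_inv hlam.ne')).congr_of_eventuallyEq
    (RSsup_eventuallyEq hlam)
  refine h2.congr_deriv ?_
  field_simp

end Potential

/-- **Properties of the set `D` of uniqueness of the maximizer.** -/
theorem Dset_countable_compl_and_differentiability (P0 : Measure ℝ)
    [IsProbabilityMeasure P0] (hmom : Integrable (fun x => x ^ 2) P0) :
    (Set.Ioi (0 : ℝ) \ Dset P0).Countable ∧
    (∀ lam : ℝ, 0 < lam →
      (lam ∈ Dset P0 ↔ DifferentiableAt ℝ (RSsup P0) lam)) ∧
    (∀ lam ∈ Dset P0, ∀ q : ℝ, Maximizes P0 lam q →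
      deriv (RSsup P0) lam = q ^ 2 / 4) := by
  have hc := continuous_quadFE hmom
  have hg := quadFE_growth hmom
  refine ⟨?_, fun lam hlam => ⟨fun hD => ?_, fun hd => ?_⟩, fun lam hD q hq =>
    (hasDerivAt_RSsup hmom hD hq).deriv⟩
  · refine ((countable_tiltMax_not_unique (quadFE P0)).preimage inv_injective).mono ?_
    rintro lam ⟨hlam, hD⟩
    rw [mem_Dset_iff hlam] at hD
    obtain ⟨a, ha⟩ := exists_isTiltMax hc hg (inv_pos.2 hlam)
    obtain ⟨b, hb, hne⟩ : ∃ b, IsTiltMax (quadFE P0) lam⁻¹ b ∧ b ≠ a := by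
      by_contra! hall
      exact hD ⟨a, ha, hall⟩
    rcases hne.lt_or_gt with hlt | hlt
    · exact ⟨b, a, hlt, hb, ha⟩
    · exact ⟨a, b, hlt, ha, hb⟩
  · obtain ⟨q, hq, -⟩ := hD.2
    exact (hasDerivAt_RSsup hmom hD hq).differentiableAt
  · rw [mem_Dset_iff hlam]
    have ht := inv_pos.2 hlam
    have hd' := (differentiableAt_tiltSup hlam hd).hasDerivAt
    obtain ⟨a, ha⟩ := exists_isTiltMax hc hg ht
    refine ⟨a, ha, fun b hb => ?_⟩
    have h1 := ha.hasDerivAt_eq hc hg ht hd'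
    have h2 := hb.hasDerivAt_eq hc hg ht hd'
    linarith

end
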